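/- arXiv:2509.03328 — 2 statements merged into one kernel-verified Lean document; each statement's English description precedes it below -/
import Mathlib

section
/- For every Schwartz function φ : ℝ → ℝ, one has ε · ∫ | Σ_{n=1}^∞ ( 1{ΔX_n ≠ 0} − 1/2 ) · φ(εn)² | dπ → 0 as ε → 0⁺ (the series converges absolutely π-almost surely since φ is Schwartz). -/
open MeasureTheory Filter
open scoped ENNReal Topology

/-- The infinite nonnegative nearest-neighbour paths started at `0`. -/
def nonnegPaths : Set (ℕ → ℕ) :=
  {h | h 0 = 0 ∧ ∀ n : ℕ, |((h (n + 1) : ℤ)) - (h n : ℤ)| = 1}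

/-- `π` is the law of the simple random walk conditioned to stay nonnegative. -/
structure IsConditionedWalk (π : Measure (ℕ → ℕ)) : Prop where
  supp : π nonnegPaths = 1
  cyl : ∀ N : ℕ, 1 ≤ N → ∀ h ∈ nonnegPaths,
    π {g : ℕ → ℕ | ∀ i, 1 ≤ i → i ≤ N → g i = h i} = ((h N : ℝ≥0∞) + 1) / 2 ^ N

/-- The centred corner indicator `1{ΔX_n ≠ 0} - 1/2`. -/
noncomputable def centredCorner (n : ℕ) (h : ℕ → ℕ) : ℝ :=
  (if h (n + 1) + h (n - 1) ≠ 2 * h n then (1 : ℝ) else 0) - 1 / 2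

/-- The probability that the simple random walk started at `x` stays nonnegative for `m` steps. -/
noncomputable def survival : ℕ → ℕ → ℝ
  | 0, _ => 1
  | m + 1, x => (survival m (x + 1) + if x = 0 then 0 else survival m (x - 1)) / 2

lemma survival_nonneg (m x : ℕ) : 0 ≤ survival m x := by
  induction m generalizing x with
  | zero => simp [survival]
  | succ m ih =>
    have h1 := ih (x + 1)
    have h2 := ih (x - 1)
    rw [survival]
    split_ifs <;> linarith

lemma survival_le_one (m x : ℕ) : survival m x ≤ 1 := by
  induction m generalizing x with
  | zero => simp [survival]
  | succ m ih =>
    have h1 := ih (x + 1)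
    have h2 := ih (x - 1)
    rw [survival]
    split_ifs <;> linarith

lemma abs_survival_le (m x : ℕ) : |survival m x| ≤ 1 :=
  abs_le.2 ⟨by linarith [survival_nonneg m x], survival_le_one m x⟩

lemma survival_succ_le (m x : ℕ) : survival (m + 1) x ≤ survival m x := by
  induction m generalizing x with
  | zero => exact survival_le_one 1 x
  | succ m ih =>
    have h1 := ih (x + 1)
    have h2 := ih (x - 1)
    rw [survival, survival.eq_2 x m]
    split_ifs <;> linarith

/-- The walk started at `x` eventually leaves the nonnegative integers: the limiting survival
probability is a bounded harmonic function vanishing at `-1`, hence zero. -/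
lemma tendsto_survival (x : ℕ) : Tendsto (fun m => survival m x) atTop (𝓝 0) := by
  have hlim : ∀ x, ∃ l, Tendsto (fun m => survival m x) atTop (𝓝 l) := fun x =>
    ⟨_, tendsto_atTop_ciInf (antitone_nat_of_succ_le fun m => survival_succ_le m x)
      ⟨0, by rintro _ ⟨m, rfl⟩; exact survival_nonneg m x⟩⟩
  choose L hL using hlim
  have hrec : ∀ x, L x = (L (x + 1) + if x = 0 then 0 else L (x - 1)) / 2 := fun x => by
    refine tendsto_nhds_unique ((tendsto_add_atTop_iff_nat 1).2 (hL x)) ?_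
    simp only [survival]
    refine ((hL (x + 1)).add ?_).div_const 2
    split_ifs
    · exact tendsto_const_nhds
    · exact hL (x - 1)
  have hlin : ∀ x : ℕ, L x = (x + 1) * L 0 ∧ L (x + 1) = (x + 2) * L 0 := fun x => by
    induction x with
    | zero =>
      have := hrec 0
      simp only [if_true] at this
      constructor <;> push_cast <;> linarith
    | succ x ih =>
      have := hrec (x + 1)
      simp only [Nat.succ_ne_zero, if_false, Nat.add_sub_cancel] at this
      push_cast
      constructor
      · linarith
      · linarith
  have h0 : 0 ≤ L 0 := ge_of_tendsto' (hL 0) fun m => survival_nonneg m 0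
  have hzero : L 0 = 0 := by
    by_contra hne
    have hpos : 0 < L 0 := lt_of_le_of_ne h0 (Ne.symm hne)
    obtain ⟨n, hn⟩ := exists_nat_gt (1 / L 0)
    have h1 : L n ≤ 1 := le_of_tendsto' (hL n) fun m => survival_le_one m n
    rw [(hlin n).1] at h1
    rw [div_lt_iff₀ hpos] at hn
    linarith
  have := hL x
  rwa [(hlin x).1, hzero, mul_zero] at this

lemma integral_congr_of_fibers {α β : Type*} [MeasurableSpace α] [MeasurableSpace β]
    [Countable β] [MeasurableSingletonClass β] {μ : Measure α} {r : α → β} (hr : Measurable r)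
    {F G : α → ℝ} (hF : Integrable F μ) (hG : Integrable G μ)
    (h : ∀ b, ∫ x in r ⁻¹' {b}, F x ∂μ = ∫ x in r ⁻¹' {b}, G x ∂μ) :
    ∫ x, F x ∂μ = ∫ x, G x ∂μ := by
  have hU : (⋃ b, r ⁻¹' {b}) = Set.univ := by ext; simp
  have hd : Pairwise (Function.onFun Disjoint fun b => r ⁻¹' {b}) := fun a b hab =>
    Disjoint.preimage r (by simpa using hab)
  have hm : ∀ b, MeasurableSet (r ⁻¹' {b}) := fun b => hr (measurableSet_singleton b)
  rw [← setIntegral_univ, ← setIntegral_univ (f := G), ← hU,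
    integral_iUnion hm hd hF.integrableOn, integral_iUnion hm hd hG.integrableOn]
  simp only [h]

lemma measurableSet_cylinder (N : ℕ) (h : ℕ → ℕ) :
    MeasurableSet {g : ℕ → ℕ | ∀ i, 1 ≤ i → i ≤ N → g i = h i} := by
  have : {g : ℕ → ℕ | ∀ i, 1 ≤ i → i ≤ N → g i = h i} =
      ⋂ i, ⋂ (_ : 1 ≤ i), ⋂ (_ : i ≤ N), (fun g : ℕ → ℕ => g i) ⁻¹' {h i} := by
    ext; simp
  rw [this]
  exact MeasurableSet.iInter fun i => MeasurableSet.iInter fun _ => MeasurableSet.iInter fun _ =>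
    measurable_pi_apply i (measurableSet_singleton _)

lemma measurableSet_nonnegPaths : MeasurableSet nonnegPaths := by
  have : nonnegPaths = (fun g : ℕ → ℕ => g 0) ⁻¹' {0} ∩
      ⋂ n, (fun g : ℕ → ℕ => (g (n + 1), g n)) ⁻¹' {p : ℕ × ℕ | |(p.1 : ℤ) - p.2| = 1} := by
    ext; simp [nonnegPaths]
  rw [this]
  refine (measurable_pi_apply 0 (measurableSet_singleton _)).inter
    (MeasurableSet.iInter fun n => ?_)
  exact ((measurable_pi_apply (n + 1)).prodMk (measurable_pi_apply n))
    (Set.to_countable _).measurableSet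

/-- Follow `h` up to time `m`, jump to `y`, and go up forever. -/
def continueAt (m : ℕ) (h : ℕ → ℕ) (y : ℕ) : ℕ → ℕ :=
  fun i => if i ≤ m then h i else y + (i - (m + 1))

lemma continueAt_mem {m : ℕ} {h : ℕ → ℕ} (hh : h ∈ nonnegPaths) {y : ℕ}
    (hy : |(y : ℤ) - h m| = 1) : continueAt m h y ∈ nonnegPaths := by
  refine ⟨by simp [continueAt, hh.1], fun n => ?_⟩
  unfold continueAt
  rcases lt_trichotomy n m with hn | rfl | hn
  · rw [if_pos (by omega), if_pos (by omega)]
    exact hh.2 n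
  · simpa using hy
  · rw [if_neg (by omega), if_neg (by omega), Nat.cast_add, Nat.cast_add,
      show n + 1 - (m + 1) = (n - (m + 1)) + 1 by omega]
    push_cast
    ring_nf
    simp

namespace IsConditionedWalk

variable {π : Measure (ℕ → ℕ)}

lemma ae_mem [IsProbabilityMeasure π] (hπ : IsConditionedWalk π) : ∀ᵐ h ∂π, h ∈ nonnegPaths :=
  (mem_ae_iff_prob_eq_one measurableSet_nonnegPaths).2 hπ.supp

lemma real_cyl (hπ : IsConditionedWalk π) {N : ℕ} (hN : 1 ≤ N) {h : ℕ → ℕ}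
    (hh : h ∈ nonnegPaths) :
    π.real {g : ℕ → ℕ | ∀ i, 1 ≤ i → i ≤ N → g i = h i} = ((h N : ℝ) + 1) / 2 ^ N := by
  rw [measureReal_def, hπ.cyl N hN h hh, ENNReal.toReal_div, ENNReal.toReal_add (by simp) (by simp)]
  simp

lemma real_cyl_succ (hπ : IsConditionedWalk π) {m : ℕ} {h : ℕ → ℕ}
    (hh : h ∈ nonnegPaths) {y : ℕ} (hy : |(y : ℤ) - h m| = 1) :
    π.real ({g : ℕ → ℕ | g (m + 1) = y} ∩ {g : ℕ → ℕ | ∀ i, 1 ≤ i → i ≤ m → g i = h i}) =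
      ((y : ℝ) + 1) / 2 ^ (m + 1) := by
  have := hπ.real_cyl (Nat.le_add_left 1 m) (continueAt_mem hh hy)
  rw [show ((continueAt m h y (m + 1) : ℕ) : ℝ) = y by simp [continueAt]] at this
  rw [← this]
  congr 1
  ext g
  simp only [Set.mem_inter_iff, Set.mem_ofPred_eq, continueAt]
  constructor
  · rintro ⟨h1, h2⟩ i hi hi'
    split_ifs with hle
    · exact h2 i hi hle
    · obtain rfl : i = m + 1 := by omega
      simp [h1]
  · intro H
    refine ⟨by simpa using H (m + 1) (by omega) le_rfl, fun i hi hi' => ?_⟩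
    simpa [hi'] using H i hi (by omega)

variable [IsProbabilityMeasure π]

/-- The Markov property, with the transition probabilities of the conditioned walk. -/
lemma integral_succ (hπ : IsConditionedWalk π) {m : ℕ} (hm : 1 ≤ m) {Φ : (ℕ → ℕ) → ℕ → ℝ} {C : ℝ}
    (hmeas : ∀ y, Measurable fun h => Φ h y) (hC : ∀ h y, |Φ h y| ≤ C)
    (hdep : ∀ g h : ℕ → ℕ, (∀ i ≤ m, g i = h i) → Φ g = Φ h) :
    ∫ h, Φ h (h (m + 1)) ∂π =
      ∫ h, (((h m : ℝ) + 2) * Φ h (h m + 1) + h m * Φ h (h m - 1)) / (2 * (h m + 1)) ∂π := by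
  have hjoint : Measurable fun p : (ℕ → ℕ) × ℕ => Φ p.1 p.2 :=
    measurable_from_prod_countable_left hmeas
  have hcomp : ∀ {f : (ℕ → ℕ) → ℕ}, Measurable f → Measurable fun h => Φ h (f h) := fun hf =>
    hjoint.comp (measurable_id.prodMk hf)
  have hXm : Measurable fun h : ℕ → ℕ => h m := measurable_pi_apply m
  have hXr : Measurable fun h : ℕ → ℕ => (h m : ℝ) := measurable_from_top.comp hXm
  have hF : Integrable (fun h => Φ h (h (m + 1))) π :=
    Integrable.of_bound (hcomp (measurable_pi_apply _)).aestronglyMeasurable C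
      (Eventually.of_forall fun h => hC _ _)
  have hG : Integrable (fun h : ℕ → ℕ =>
      (((h m : ℝ) + 2) * Φ h (h m + 1) + h m * Φ h (h m - 1)) / (2 * (h m + 1))) π := by
    refine Integrable.of_bound (C := C) (Measurable.aestronglyMeasurable ?_)
      (Eventually.of_forall fun h => ?_)
    · exact (((hXr.add_const 2).mul (hcomp (f := fun h => h m + 1)
        ((measurable_from_top (f := fun x : ℕ => x + 1)).comp hXm))).add
        (hXr.mul (hcomp (f := fun h => h m - 1)
          ((measurable_from_top (f := fun x : ℕ => x - 1)).comp hXm)))).div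
          ((hXr.add_const 1).const_mul 2)
    · have hx : (0 : ℝ) ≤ h m := Nat.cast_nonneg _
      obtain ⟨h1, h1'⟩ := abs_le.1 (hC h (h m + 1))
      obtain ⟨h2, h2'⟩ := abs_le.1 (hC h (h m - 1))
      rw [Real.norm_eq_abs, abs_le, le_div_iff₀ (by positivity), div_le_iff₀ (by positivity)]
      constructor <;> nlinarith
  let r : (ℕ → ℕ) → (Fin m → ℕ) := fun h i => h (i + 1)
  have hr : Measurable r := measurable_pi_lambda _ fun i => measurable_pi_apply _
  refine integral_congr_of_fibers hr hF hG fun b => ?_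
  by_cases hb : ∃ h ∈ nonnegPaths, r h = b
  swap
  · have h0 : π (r ⁻¹' {b}) = 0 :=
      measure_mono_null (fun g hg hg' => hb ⟨g, hg', hg⟩) (ae_iff.1 hπ.ae_mem)
    rw [setIntegral_measure_zero _ h0, setIntegral_measure_zero _ h0]
  obtain ⟨h, hh, rfl⟩ := hb
  have hfib : r ⁻¹' {r h} = {g : ℕ → ℕ | ∀ i, 1 ≤ i → i ≤ m → g i = h i} := by
    ext g
    simp only [Set.mem_preimage, Set.mem_singleton_iff, Set.mem_ofPred_eq, r, funext_iff]
    constructor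
    · intro H i hi hi'
      have := H ⟨i - 1, by omega⟩
      simpa [Nat.sub_add_cancel hi] using this
    · intro H i
      exact H _ (by omega) (by omega)
  rw [hfib]
  set A := {g : ℕ → ℕ | ∀ i, 1 ≤ i → i ≤ m → g i = h i}
  have hAm : MeasurableSet A := measurableSet_cylinder m h
  have hagree : ∀ g ∈ A, g ∈ nonnegPaths → ∀ i ≤ m, g i = h i := fun g hg hg' i hi => by
    rcases Nat.eq_zero_or_pos i with rfl | hpos
    · rw [hg'.1, hh.1]
    · exact hg i hpos hi
  have hS : ∀ y, MeasurableSet {g : ℕ → ℕ | g (m + 1) = y} := fun y =>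
    (measurable_pi_apply (m + 1) : Measurable fun g : ℕ → ℕ => g (m + 1))
      (measurableSet_singleton y)
  have hstep : ∀ y, ∫ g in A, Set.indicator {g : ℕ → ℕ | g (m + 1) = y} (fun _ => Φ h y) g ∂π =
      π.real ({g : ℕ → ℕ | g (m + 1) = y} ∩ A) * Φ h y := fun y => by
    rw [integral_indicator (hS y), setIntegral_const, smul_eq_mul, measureReal_restrict_apply (hS y)]
  have hint : ∀ y, Integrable
      (Set.indicator {g : ℕ → ℕ | g (m + 1) = y} (fun _ => Φ h y)) (π.restrict A) := fun y =>
    (integrable_const _).indicator (hS y)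
  have hrhs : ∫ g in A, (((g m : ℝ) + 2) * Φ g (g m + 1) + g m * Φ g (g m - 1)) /
      (2 * (g m + 1)) ∂π =
      ((h m : ℝ) + 1) / 2 ^ m *
        ((((h m : ℝ) + 2) * Φ h (h m + 1) + h m * Φ h (h m - 1)) / (2 * (h m + 1))) := by
    rw [← hπ.real_cyl hm hh, ← smul_eq_mul, ← setIntegral_const]
    refine setIntegral_congr_ae hAm ?_
    filter_upwards [hπ.ae_mem] with g hg hgA
    rw [hdep g h (hagree g hgA hg), hagree g hgA hg m le_rfl]
  have hup := hπ.real_cyl_succ (m := m) hh (y := h m + 1) (by simp)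
  rw [hrhs]
  rcases Nat.eq_zero_or_pos (h m) with hk | hk
  · have hlhs : ∫ g in A, Φ g (g (m + 1)) ∂π = ∫ g in A,
        Set.indicator {g : ℕ → ℕ | g (m + 1) = h m + 1} (fun _ => Φ h (h m + 1)) g ∂π := by
      refine setIntegral_congr_ae hAm ?_
      filter_upwards [hπ.ae_mem] with g hg hgA
      have h1 := hagree g hgA hg m le_rfl
      have h2 := hg.2 m
      have h3 : g (m + 1) = h m + 1 := by
        rcases (abs_eq (by norm_num)).1 h2 with h2 | h2 <;> omega
      rw [Set.indicator_of_mem (by exact h3), hdep g h (hagree g hgA hg), h3]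
    rw [hlhs, hstep, hup, hk]
    push_cast
    field_simp
    ring
  · have hlhs : ∫ g in A, Φ g (g (m + 1)) ∂π = ∫ g in A,
        (Set.indicator {g : ℕ → ℕ | g (m + 1) = h m + 1} (fun _ => Φ h (h m + 1)) g +
          Set.indicator {g : ℕ → ℕ | g (m + 1) = h m - 1} (fun _ => Φ h (h m - 1)) g) ∂π := by
      refine setIntegral_congr_ae hAm ?_
      filter_upwards [hπ.ae_mem] with g hg hgA
      have h1 := hagree g hgA hg m le_rfl
      have h2 := hg.2 m
      have h3 : g (m + 1) = h m + 1 ∨ g (m + 1) = h m - 1 := by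
        rcases (abs_eq (by norm_num)).1 h2 with h2 | h2 <;> omega
      rw [hdep g h (hagree g hgA hg)]
      rcases h3 with h3 | h3
      · rw [Set.indicator_of_mem (by exact h3), Set.indicator_of_notMem, h3, add_zero]
        simp only [Set.mem_ofPred_eq]
        omega
      · rw [Set.indicator_of_notMem, Set.indicator_of_mem (by exact h3), h3, zero_add]
        simp only [Set.mem_ofPred_eq]
        omega
    have hdown := hπ.real_cyl_succ (m := m) hh (y := h m - 1) (by
      rw [Nat.cast_sub hk]; simp)
    rw [hlhs, integral_add (hint _) (hint _), hstep, hstep, hup, hdown, Nat.cast_sub hk]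
    push_cast
    field_simp
    ring

lemma integrable_inv (m : ℕ) {f : ℕ → ℝ} (hf : ∀ x, |f x| ≤ 1) :
    Integrable (fun h : ℕ → ℕ => f (h m) / ((h m : ℝ) + 1)) π := by
  refine Integrable.of_bound (C := 1) (Measurable.aestronglyMeasurable ?_)
    (Eventually.of_forall fun h => ?_)
  · exact (measurable_from_top (f := fun x : ℕ => f x / ((x : ℝ) + 1))).comp (measurable_pi_apply m)
  · have hx : (0 : ℝ) ≤ h m := Nat.cast_nonneg _
    rw [Real.norm_eq_abs, abs_div, abs_of_pos (by positivity : (0 : ℝ) < h m + 1),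
      div_le_one (by positivity)]
    linarith [hf (h m)]

lemma integral_survival_div (hπ : IsConditionedWalk π) (m j : ℕ) :
    ∫ h, survival j (h (m + 1)) / ((h (m + 1) : ℝ) + 1) ∂π =
      ∫ h, survival (j + m) (h 1) / ((h 1 : ℝ) + 1) ∂π := by
  induction m generalizing j with
  | zero => rfl
  | succ m ih =>
    rw [show j + (m + 1) = (j + 1) + m by ring, ← ih,
      hπ.integral_succ (m := m + 1) (by omega) (C := 1)
        (Φ := fun _ y => survival j y / ((y : ℝ) + 1)) (fun _ => measurable_const)
        (fun _ y => ?_) (fun _ _ _ => rfl)]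
    · refine integral_congr_ae (Eventually.of_forall fun h => ?_)
      simp only [survival]
      rcases Nat.eq_zero_or_pos (h (m + 1)) with hk | hk
      · simp only [hk, if_true]
        push_cast
        field_simp
        ring
      · obtain ⟨k, hk⟩ := Nat.exists_eq_succ_of_ne_zero hk.ne'
        simp only [hk, Nat.succ_ne_zero, if_false, Nat.succ_eq_add_one, Nat.add_sub_cancel]
        push_cast
        field_simp
        ring
    · have hy : (0 : ℝ) ≤ y := Nat.cast_nonneg _
      rw [abs_div, abs_of_pos (by positivity : (0 : ℝ) < y + 1), div_le_one (by positivity)]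
      linarith [abs_survival_le j y]

/-- The conditioned walk is transient, in the form `𝔼[1 / (X_m + 1)] → 0`. -/
lemma tendsto_integral_inv (hπ : IsConditionedWalk π) :
    Tendsto (fun m : ℕ => ∫ h, 1 / ((h m : ℝ) + 1) ∂π) atTop (𝓝 0) := by
  rw [← tendsto_add_atTop_iff_nat 1]
  have heq : ∀ m : ℕ, ∫ h, 1 / ((h (m + 1) : ℝ) + 1) ∂π =
      ∫ h, survival m (h 1) / ((h 1 : ℝ) + 1) ∂π := fun m => by
    simpa [survival] using hπ.integral_survival_div m 0
  simp only [heq]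
  rw [show (0 : ℝ) = ∫ _ : ℕ → ℕ, (0 : ℝ) ∂π by simp]
  refine tendsto_integral_of_dominated_convergence (fun _ => 1)
    (fun m => (integrable_inv 1 (abs_survival_le m)).aestronglyMeasurable) (integrable_const _)
    (fun m => Eventually.of_forall fun h => ?_) (Eventually.of_forall fun h => ?_)
  · have hy : (0 : ℝ) ≤ h 1 := Nat.cast_nonneg _
    rw [Real.norm_eq_abs, abs_div, abs_of_pos (by positivity : (0 : ℝ) < (h 1 : ℝ) + 1),
      div_le_one (by positivity)]
    linarith [abs_survival_le m (h 1)]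
  · simpa using (tendsto_survival (h 1)).div_const ((h 1 : ℝ) + 1)

end IsConditionedWalk

lemma abs_centredCorner (n : ℕ) (h : ℕ → ℕ) : |centredCorner n h| = 1 / 2 := by
  unfold centredCorner
  split_ifs <;> norm_num [abs_of_pos, abs_of_neg]

lemma measurable_ite_corner (m : ℕ) {f : (ℕ → ℕ) → ℕ} (hf : Measurable f) :
    Measurable fun h : ℕ → ℕ => (if f h + h (m - 1) ≠ 2 * h m then (1 : ℝ) else 0) - 1 / 2 :=
  (Measurable.of_discrete (f := fun p : ℕ × ℕ × ℕ =>
    (if p.1 + p.2.1 ≠ 2 * p.2.2 then (1 : ℝ) else 0) - 1 / 2)).comp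
      (hf.prodMk ((measurable_pi_apply (m - 1)).prodMk (measurable_pi_apply m)))

lemma measurable_centredCorner (n : ℕ) : Measurable (centredCorner n) :=
  measurable_ite_corner n (measurable_pi_apply (n + 1))

lemma integrable_mul_centredCorner {π : Measure (ℕ → ℕ)} [IsProbabilityMeasure π] (n m : ℕ) :
    Integrable (fun h => centredCorner n h * centredCorner m h) π :=
  Integrable.of_bound (C := 1 / 4)
    ((measurable_centredCorner n).mul (measurable_centredCorner m)).aestronglyMeasurable
    (Eventually.of_forall fun h => by
      rw [Real.norm_eq_abs, abs_mul, abs_centredCorner, abs_centredCorner]; norm_num)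

namespace IsConditionedWalk

variable {π : Measure (ℕ → ℕ)} [IsProbabilityMeasure π]

lemma abs_integral_mul_centredCorner_le_of_lt (hπ : IsConditionedWalk π) {n m : ℕ} (hnm : n < m) :
    |∫ h, centredCorner n h * centredCorner m h ∂π| ≤ ∫ h, 1 / ((h m : ℝ) + 1) ∂π := by
  have hMarkov := hπ.integral_succ (m := m) (by omega) (C := 1 / 4)
    (Φ := fun h y => centredCorner n h *
      ((if y + h (m - 1) ≠ 2 * h m then (1 : ℝ) else 0) - 1 / 2))
    (fun y => (measurable_centredCorner n).mul (measurable_ite_corner m measurable_const))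
    (fun h y => by
      rw [abs_mul, abs_centredCorner]
      split_ifs <;> norm_num [abs_of_pos, abs_of_neg])
    (fun g h hgh => by
      funext y
      simp only [centredCorner, hgh n hnm.le, hgh (n + 1) hnm, hgh (n - 1) (by omega),
        hgh (m - 1) (by omega), hgh m le_rfl])
  have hfold : ∫ h, centredCorner n h * centredCorner m h ∂π = _ := hMarkov
  rw [hfold, ← Real.norm_eq_abs]
  refine norm_integral_le_of_norm_le (integrable_inv (f := fun _ => 1) m (by simp)) ?_
  filter_upwards [hπ.ae_mem] with h hh
  have hx : (0 : ℝ) ≤ h m := Nat.cast_nonneg _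
  have h2 := hh.2 (m - 1)
  rw [Nat.sub_add_cancel (by omega)] at h2
  have hkey : ∀ c : ℝ, |c| ≤ 1 → |(centredCorner n h * c) / (2 * ((h m : ℝ) + 1))| ≤
      1 / ((h m : ℝ) + 1) := fun c hc => by
    rw [abs_div, abs_mul, abs_centredCorner,
      abs_of_pos (by positivity : (0 : ℝ) < 2 * ((h m : ℝ) + 1)),
      div_le_div_iff₀ (by positivity) (by positivity)]
    nlinarith
  rw [Real.norm_eq_abs]
  rcases (abs_eq (by norm_num)).1 h2 with h2 | h2
  · have hprev : h m = h (m - 1) + 1 := by omega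
    convert hkey (-1) (by norm_num) using 3
    rw [if_neg (by omega), if_pos (by omega)]
    ring
  · have hprev : h (m - 1) = h m + 1 := by omega
    convert hkey 1 (by norm_num) using 3
    rw [if_pos (by omega)]
    rcases Nat.eq_zero_or_pos (h m) with hk | hk
    · rw [hk]
      push_cast
      ring
    · rw [if_neg (by omega)]
      ring

lemma abs_integral_mul_centredCorner_le (hπ : IsConditionedWalk π) (n m : ℕ) :
    |∫ h, centredCorner n h * centredCorner m h ∂π| ≤
      (∫ h, 1 / ((h n : ℝ) + 1) ∂π) + (∫ h, 1 / ((h m : ℝ) + 1) ∂π) + if n = m then 1 else 0 := by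
  have hpos : ∀ k : ℕ, 0 ≤ ∫ h, 1 / ((h k : ℝ) + 1) ∂π := fun k =>
    integral_nonneg fun h => by positivity
  rcases lt_trichotomy n m with hnm | rfl | hnm
  · rw [if_neg hnm.ne]
    linarith [hpos n, hπ.abs_integral_mul_centredCorner_le_of_lt hnm]
  · have : |∫ h, centredCorner n h * centredCorner n h ∂π| ≤ 1 := by
      rw [← Real.norm_eq_abs]
      refine (norm_integral_le_of_norm_le_const (C := 1) (Eventually.of_forall fun h => ?_)).trans
        (by simp)
      rw [Real.norm_eq_abs, abs_mul, abs_centredCorner]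
      norm_num
    rw [if_pos rfl]
    linarith [hpos n]
  · simp only [mul_comm (centredCorner n _)]
    rw [if_neg hnm.ne']
    linarith [hpos m, hπ.abs_integral_mul_centredCorner_le_of_lt hnm]

/-- Second moment bound for weighted sums of centred corner indicators. -/
lemma integral_sq_sum_le (hπ : IsConditionedWalk π) {w : ℕ → ℝ} (hw : ∀ n, 0 ≤ w n) (N : ℕ) :
    ∫ h, (∑ n ∈ Finset.range N, centredCorner n h * w n) ^ 2 ∂π ≤
      2 * (∑ n ∈ Finset.range N, w n) *
        (∑ n ∈ Finset.range N, (∫ h, 1 / ((h n : ℝ) + 1) ∂π) * w n) +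
      ∑ n ∈ Finset.range N, w n ^ 2 := by
  set q : ℕ → ℝ := fun k => ∫ h, 1 / ((h k : ℝ) + 1) ∂π
  have hexp : ∀ h : ℕ → ℕ, (∑ n ∈ Finset.range N, centredCorner n h * w n) ^ 2 =
      ∑ n ∈ Finset.range N, ∑ m ∈ Finset.range N,
        centredCorner n h * centredCorner m h * (w n * w m) := fun h => by
    rw [sq, Finset.sum_mul_sum]
    exact Finset.sum_congr rfl fun n _ => Finset.sum_congr rfl fun m _ => by ring
  simp only [hexp]
  rw [integral_finsetSum _ fun n _ => integrable_finsetSum _ fun m _ =>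
    (integrable_mul_centredCorner n m).mul_const _]
  calc _ = ∑ n ∈ Finset.range N, ∑ m ∈ Finset.range N,
        (∫ h, centredCorner n h * centredCorner m h ∂π) * (w n * w m) := by
        refine Finset.sum_congr rfl fun n _ => ?_
        rw [integral_finsetSum _ fun m _ => (integrable_mul_centredCorner n m).mul_const _]
        exact Finset.sum_congr rfl fun m _ => integral_mul_const _ _
    _ ≤ ∑ n ∈ Finset.range N, ∑ m ∈ Finset.range N,
        (q n * w n * w m + w n * (q m * w m) + if n = m then w n * w m else 0) := by
        refine Finset.sum_le_sum fun n _ => Finset.sum_le_sum fun m _ => ?_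
        refine (mul_le_mul_of_nonneg_right ((le_abs_self _).trans
          (hπ.abs_integral_mul_centredCorner_le n m)) (mul_nonneg (hw n) (hw m))).trans (le_of_eq ?_)
        split_ifs <;> ring
    _ = _ := by
        simp only [Finset.sum_add_distrib, ← Finset.mul_sum, ← Finset.sum_mul]
        have hdiag : ∑ n ∈ Finset.range N, ∑ m ∈ Finset.range N,
            (if n = m then w n * w m else 0) = ∑ n ∈ Finset.range N, w n ^ 2 := by
          refine Finset.sum_congr rfl fun n hn => ?_
          rw [Finset.sum_ite_eq, if_pos hn, sq]
        rw [hdiag]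
        ring

/-- First moment bound for weighted sums of centred corner indicators, for a weight of scale
`1 / ε`. -/
lemma integral_abs_tsum_le (hπ : IsConditionedWalk π) {w : ℕ → ℝ} (hw : ∀ n, 0 ≤ w n)
    {ε K η δ : ℝ} {M : ℕ} (hε : 0 < ε) (hδ : 0 < δ) (hwK : ∀ n, w n ≤ K)
    (hsum : ∀ N, ε * ∑ n ∈ Finset.range N, w n ≤ K)
    (hη : 0 ≤ η) (hM : ∀ m ≥ M, ∫ h, 1 / ((h m : ℝ) + 1) ∂π ≤ η) :
    ε * ∫ h, |∑' n, centredCorner n h * w n| ∂π ≤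
      δ + (2 * K * (η * K + ε * (M * K)) + ε * K ^ 2) / δ := by
  have hK : 0 ≤ K := (hw 0).trans (hwK 0)
  have hW : ∀ N, ∑ n ∈ Finset.range N, w n ≤ K / ε := fun N => by
    rw [le_div_iff₀ hε, mul_comm]; exact hsum N
  have hWnn : ∀ N, 0 ≤ ∑ n ∈ Finset.range N, w n := fun N => Finset.sum_nonneg fun n _ => hw n
  have hws : Summable w := summable_of_sum_range_le hw hW
  have hS : ∀ h, Summable fun n => centredCorner n h * w n := fun h =>
    Summable.of_norm_bounded hws fun n => by
      rw [Real.norm_eq_abs, abs_mul, abs_centredCorner, abs_of_nonneg (hw n)]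
      linarith [hw n]
  have hSbound : ∀ h N, |∑ n ∈ Finset.range N, centredCorner n h * w n| ≤ K / ε := fun h N => by
    refine (Finset.abs_sum_le_sum_abs _ _).trans (le_trans ?_ (hW N))
    refine Finset.sum_le_sum fun n _ => ?_
    rw [abs_mul, abs_centredCorner, abs_of_nonneg (hw n)]
    linarith [hw n]
  have hSmeas : ∀ N, Measurable fun h => ∑ n ∈ Finset.range N, centredCorner n h * w n := fun N =>
    Finset.measurable_fun_sum _ fun n _ => (measurable_centredCorner n).mul_const _
  have hq : ∀ n, ∫ h, 1 / ((h n : ℝ) + 1) ∂π ≤ η + if n < M then 1 else 0 := fun n => by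
    split_ifs with hn
    · have : ∫ h, 1 / ((h n : ℝ) + 1) ∂π ≤ ∫ _, (1 : ℝ) ∂π :=
        integral_mono (integrable_inv (f := fun _ => 1) n (by simp)) (integrable_const _)
          fun h => (div_le_one (by positivity)).2 (by simp)
      simp only [integral_const, probReal_univ, smul_eq_mul, mul_one] at this
      linarith
    · simpa using hM n (not_lt.1 hn)
  have hfin : ∀ N, ε * ∫ h, |∑ n ∈ Finset.range N, centredCorner n h * w n| ∂π ≤
      δ + (2 * K * (η * K + ε * (M * K)) + ε * K ^ 2) / δ := fun N => by
    set S : (ℕ → ℕ) → ℝ := fun h => ∑ n ∈ Finset.range N, centredCorner n h * w n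
    have hS2int : Integrable (fun h => S h ^ 2) π :=
      Integrable.of_bound (C := (K / ε) ^ 2) ((hSmeas N).pow_const 2).aestronglyMeasurable
        (Eventually.of_forall fun h => by
          rw [Real.norm_eq_abs, abs_pow]
          exact pow_le_pow_left₀ (abs_nonneg _) (hSbound h N) 2)
    have hamgm : ε * ∫ h, |S h| ∂π ≤ δ + ε ^ 2 * (∫ h, S h ^ 2 ∂π) / δ := by
      have : ∫ h, ε * |S h| ∂π ≤ ∫ h, (δ + ε ^ 2 / δ * S h ^ 2) ∂π := by
        refine integral_mono_of_nonneg (Eventually.of_forall fun h => by positivity)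
          ((integrable_const _).add (hS2int.const_mul _)) (Eventually.of_forall fun h => ?_)
        have hd : δ + ε ^ 2 / δ * S h ^ 2 = (δ ^ 2 + (ε * |S h|) ^ 2) / δ := by
          rw [mul_pow, sq_abs]; field_simp
        simp only
        rw [hd, le_div_iff₀ hδ]
        nlinarith [sq_nonneg (δ - ε * |S h|), mul_nonneg hε.le (abs_nonneg (S h))]
      rw [integral_const_mul, integral_add (integrable_const _) (hS2int.const_mul _),
        integral_const_mul] at this
      simp only [integral_const, probReal_univ, smul_eq_mul, one_mul] at this
      calc _ ≤ _ := this
        _ = _ := by ring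
    refine hamgm.trans (add_le_add le_rfl (div_le_div_of_nonneg_right ?_ hδ.le))
    have hqsum : ∑ n ∈ Finset.range N, (∫ h, 1 / ((h n : ℝ) + 1) ∂π) * w n ≤
        η * (∑ n ∈ Finset.range N, w n) + M * K := by
      calc _ ≤ ∑ n ∈ Finset.range N, (η * w n + if n < M then w n else 0) := by
            refine Finset.sum_le_sum fun n _ => ?_
            refine (mul_le_mul_of_nonneg_right (hq n) (hw n)).trans (le_of_eq ?_)
            split_ifs <;> ring
        _ ≤ _ := by
            rw [Finset.sum_add_distrib, ← Finset.mul_sum, ← Finset.sum_filter]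
            gcongr
            calc _ ≤ ∑ n ∈ Finset.range M, w n :=
                  Finset.sum_le_sum_of_subset_of_nonneg
                    (fun n hn => Finset.mem_range.2 (Finset.mem_filter.1 hn).2) fun n _ _ => hw n
              _ ≤ ∑ n ∈ Finset.range M, K := Finset.sum_le_sum fun n _ => hwK n
              _ = _ := by simp
    have hsq : ∑ n ∈ Finset.range N, w n ^ 2 ≤ K * ∑ n ∈ Finset.range N, w n := by
      rw [Finset.mul_sum]
      exact Finset.sum_le_sum fun n _ => by nlinarith [hw n, hwK n]
    have hmain := hπ.integral_sq_sum_le hw N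
    set W := ∑ n ∈ Finset.range N, w n
    have hWK : ε * W ≤ K := hsum N
    have hεW : 0 ≤ ε * W := mul_nonneg hε.le (hWnn N)
    calc ε ^ 2 * ∫ h, S h ^ 2 ∂π
        ≤ ε ^ 2 * (2 * W * (η * W + M * K) + K * W) := by
          refine mul_le_mul_of_nonneg_left (hmain.trans ?_) (by positivity)
          have := hWnn N
          gcongr
      _ = 2 * (ε * W) * (η * (ε * W) + ε * (M * K)) + ε * (K * (ε * W)) := by ring
      _ ≤ 2 * K * (η * K + ε * (M * K)) + ε * (K * K) := by gcongr
      _ = _ := by ring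
  have hlim : Tendsto (fun N => ∫ h, |∑ n ∈ Finset.range N, centredCorner n h * w n| ∂π) atTop
      (𝓝 (∫ h, |∑' n, centredCorner n h * w n| ∂π)) :=
    tendsto_integral_of_dominated_convergence (fun _ => K / ε)
      (fun N => (hSmeas N).abs.aestronglyMeasurable) (integrable_const _)
      (fun N => Eventually.of_forall fun h => by
        rw [Real.norm_eq_abs, abs_abs]; exact hSbound h N)
      (Eventually.of_forall fun h => (hS h).hasSum.tendsto_sum_nat.abs)
  exact le_of_tendsto' (hlim.const_mul ε) hfin

end IsConditionedWalk

/-- Riemann sums of `x ↦ (1 + x)⁻²` are bounded by the integral. -/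
lemma mul_sum_one_div_sq_le {ε : ℝ} (hε : 0 < ε) (N : ℕ) :
    ε * ∑ n ∈ Finset.range N, (if 1 ≤ n then 1 / (1 + ε * n) ^ 2 else 0) ≤ 1 := by
  have key : ∀ N : ℕ, ε * ∑ n ∈ Finset.range (N + 1), (if 1 ≤ n then 1 / (1 + ε * n) ^ 2 else 0) ≤
      1 - 1 / (1 + ε * N) := fun N => by
    induction N with
    | zero => simp
    | succ N ih =>
      rw [Finset.sum_range_succ, mul_add, if_pos (by omega)]
      have hstep : ε * (1 / (1 + ε * ((N + 1 : ℕ) : ℝ)) ^ 2) ≤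
          1 / (1 + ε * N) - 1 / (1 + ε * ((N + 1 : ℕ) : ℝ)) := by
        push_cast
        rw [div_sub_div _ _ (by positivity) (by positivity), mul_one_div,
          div_le_div_iff₀ (by positivity) (by positivity)]
        have ha : 0 < 1 + ε * (N : ℝ) := by positivity
        have hb : 0 < 1 + ε * ((N : ℝ) + 1) := by positivity
        have : 0 ≤ ε ^ 2 * (1 + ε * ((N : ℝ) + 1)) := by positivity
        have h3 : 0 ≤ ε ^ 2 := by positivity
        nlinarith
      linarith
  rcases N with _ | N
  · simp
  · have : 0 ≤ 1 / (1 + ε * (N : ℝ)) := by positivity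
    linarith [key N]

lemma SchwartzMap.exists_sq_le (φ : SchwartzMap ℝ ℝ) :
    ∃ K : ℝ, 0 ≤ K ∧ ∀ x : ℝ, 0 ≤ x → φ x ^ 2 ≤ K * (1 / (1 + x) ^ 2) := by
  obtain ⟨A, hA⟩ := φ.decay 0 0
  obtain ⟨B, hB⟩ := φ.decay 1 0
  refine ⟨(A + B) ^ 2, sq_nonneg _, fun x hx => ?_⟩
  have h1 := hA.2 x
  have h2 := hB.2 x
  simp only [norm_iteratedFDeriv_zero, pow_zero, one_mul, pow_one, Real.norm_eq_abs,
    abs_of_nonneg hx] at h1 h2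
  rw [mul_one_div, le_div_iff₀ (by positivity), ← mul_pow, ← sq_abs, abs_mul,
    abs_of_nonneg (by linarith : 0 ≤ 1 + x)]
  exact pow_le_pow_left₀ (by positivity) (by linarith) 2

/-- Concentration of the number of corners under the invariant measure: for every
Schwartz `φ`, `ε ∫ |Σ_{n ≥ 1} (1{ΔX_n ≠ 0} - 1/2) φ(εn)²| dπ → 0` as `ε → 0⁺`. -/
theorem stmt18 (π : Measure (ℕ → ℕ)) [IsProbabilityMeasure π]
    (hsupp : π {h : ℕ → ℕ | h 0 = 0 ∧ ∀ n : ℕ, |((h (n + 1) : ℤ)) - (h n : ℤ)| = 1} = 1)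
    (hcyl : ∀ N : ℕ, 1 ≤ N → ∀ h : ℕ → ℕ, h 0 = 0 →
      (∀ n : ℕ, |((h (n + 1) : ℤ)) - (h n : ℤ)| = 1) →
      π {g : ℕ → ℕ | ∀ i, 1 ≤ i → i ≤ N → g i = h i} = ((h N : ℝ≥0∞) + 1) / 2 ^ N)
    (φ : SchwartzMap ℝ ℝ) :
    Tendsto
      (fun ε : ℝ => ε * ∫ h,
        |∑' n : ℕ,
          if 1 ≤ n then
            ((if h (n + 1) + h (n - 1) ≠ 2 * h n then (1 : ℝ) else 0) - 1 / 2) *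
              (φ (ε * n)) ^ 2
          else 0| ∂π)
      (nhdsWithin 0 (Set.Ioi 0)) (𝓝 0) := by
  have hπ : IsConditionedWalk π := ⟨hsupp, fun N hN h hh => hcyl N hN h hh.1 hh.2⟩
  obtain ⟨K, hK, hφ⟩ := φ.exists_sq_le
  have hfun : ∀ (ε : ℝ) (h : ℕ → ℕ), (∑' n : ℕ, if 1 ≤ n then
      ((if h (n + 1) + h (n - 1) ≠ 2 * h n then (1 : ℝ) else 0) - 1 / 2) * (φ (ε * n)) ^ 2
      else 0) = ∑' n : ℕ, centredCorner n h * if 1 ≤ n then φ (ε * n) ^ 2 else 0 := fun ε h =>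
    tsum_congr fun n => by rw [mul_ite, mul_zero]; rfl
  simp only [hfun]
  have hbound : ∀ δ > 0, ∃ C : ℝ, ∀ ε > 0, ε * ∫ h,
      |∑' n : ℕ, centredCorner n h * if 1 ≤ n then φ (ε * n) ^ 2 else 0| ∂π ≤
        2 * δ + ε * C := fun δ hδ => by
    set η := δ ^ 2 / (2 * K ^ 2 + 1) with hηdef
    have hη : 0 < η := by positivity
    have hηK : 2 * K ^ 2 * η ≤ δ ^ 2 := by
      rw [hηdef, mul_div_assoc', div_le_iff₀ (by positivity)]
      nlinarith [sq_nonneg δ]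
    obtain ⟨M, hM⟩ := eventually_atTop.1 (hπ.tendsto_integral_inv.eventually_le_const hη)
    refine ⟨(2 * K * (M * K) + K ^ 2) / δ, fun ε hε => ?_⟩
    have hdom : ∀ n : ℕ, (if 1 ≤ n then φ (ε * n) ^ 2 else 0) ≤
        K * if 1 ≤ n then 1 / (1 + ε * n) ^ 2 else 0 := fun n => by
      split_ifs
      · exact hφ _ (by positivity)
      · simp
    have hmain := hπ.integral_abs_tsum_le
      (w := fun n : ℕ => if 1 ≤ n then φ (ε * n) ^ 2 else 0) (K := K) (η := η) (δ := δ) (M := M)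
      (fun n => by split_ifs <;> positivity) hε hδ
      (fun n => (hdom n).trans (mul_le_of_le_one_right hK (by
        split_ifs
        · exact (div_le_one (by positivity)).2
            (one_le_pow₀ (by linarith [mul_nonneg hε.le (Nat.cast_nonneg (α := ℝ) n)]))
        · norm_num)))
      (fun N => by
        calc _ ≤ ε * ∑ n ∈ Finset.range N, K * (if 1 ≤ n then 1 / (1 + ε * n) ^ 2 else 0) :=
              mul_le_mul_of_nonneg_left (Finset.sum_le_sum fun n _ => hdom n) hε.le
          _ = K * (ε * ∑ n ∈ Finset.range N, (if 1 ≤ n then 1 / (1 + ε * n) ^ 2 else 0)) := by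
              rw [← Finset.mul_sum]; ring
          _ ≤ K := mul_le_of_le_one_right hK (mul_sum_one_div_sq_le hε N))
      hη.le hM
    refine hmain.trans ?_
    have : (2 * K * (η * K + ε * (M * K)) + ε * K ^ 2) / δ =
        2 * K ^ 2 * η / δ + ε * ((2 * K * (M * K) + K ^ 2) / δ) := by ring
    have h2 : 2 * K ^ 2 * η / δ ≤ δ := by
      rw [div_le_iff₀ hδ]; linarith
    linarith
  rw [tendsto_order]
  refine ⟨fun a ha => ?_, fun a ha => ?_⟩
  · filter_upwards [self_mem_nhdsWithin] with ε hε
    exact ha.trans_le (mul_nonneg (le_of_lt hε) (integral_nonneg fun h => abs_nonneg _))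
  · obtain ⟨C, hC⟩ := hbound (a / 4) (by linarith)
    have hlim : Tendsto (fun ε : ℝ => 2 * (a / 4) + ε * C) (nhdsWithin 0 (Set.Ioi 0))
        (𝓝 (2 * (a / 4) + 0 * C)) :=
      ((tendsto_id.mul_const C).const_add _).mono_left nhdsWithin_le_nhds
    filter_upwards [self_mem_nhdsWithin, hlim.eventually_lt_const (by linarith : _ < a)] with ε hε h
    exact (hC ε hε).trans_lt h
end

section
/- Let ε ∈ (0, 1], T > 0, m ≥ 1 and c > 0. Let (Y_t)_{t ∈ ε²ℕ} be real random variables on a probability space, each in L^m, such that ‖Y_t − Y_s‖_{L^m} ≤ c·( |t − s|^{1/2} + ε^{3/4} ) for all grid times s, t ∈ ε²ℕ ∩ [0, T + ε²]. Let Ȳ be the piecewise linear interpolation in time: for t ≥ 0, Ȳ_t := (1 − λ)·Y_{⌊t/ε²⌋·ε²} + λ·Y_{⌈t/ε²⌉·ε²} with λ := t/ε² − ⌊t/ε²⌋. Then there exists a constant c' > 0 depending only on c and T (in particular not on ε) such that for all s, t ∈ [0, T]: ‖Ȳ_t − Ȳ_s‖_{L^m} ≤ c'·|t − s|^{3/8}.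 -/
open MeasureTheory

/-- The piecewise linear interpolation in time, on the grid `ε²ℕ`, of a discrete-time
process `Y` (where `Y i` stands for the value at time `i ε²`). -/
noncomputable def linInterp {Ω : Type*} (ε : ℝ) (Y : ℕ → Ω → ℝ) (t : ℝ) (ω : Ω) : ℝ :=
  (1 - (t / ε ^ 2 - (⌊t / ε ^ 2⌋₊ : ℝ))) * Y ⌊t / ε ^ 2⌋₊ ω +
    (t / ε ^ 2 - (⌊t / ε ^ 2⌋₊ : ℝ)) * Y ⌈t / ε ^ 2⌉₊ ω

lemma linInterp_eq_add_smul {Ω : Type*} (ε : ℝ) (Y : ℕ → Ω → ℝ) {t : ℝ} (ht : 0 ≤ t) :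
    linInterp ε Y t = Y ⌊t / ε ^ 2⌋₊ +
      (t / ε ^ 2 - (⌊t / ε ^ 2⌋₊ : ℝ)) • (Y (⌊t / ε ^ 2⌋₊ + 1) - Y ⌊t / ε ^ 2⌋₊) := by
  have hu : 0 ≤ t / ε ^ 2 := by positivity
  funext ω
  simp only [linInterp, Pi.add_apply, Pi.smul_apply, Pi.sub_apply, smul_eq_mul]
  rcases (Nat.ceil_le_floor_add_one (t / ε ^ 2)).lt_or_eq with h | h
  · have h1 : t / ε ^ 2 ≤ (⌊t / ε ^ 2⌋₊ : ℝ) :=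
      (Nat.le_ceil _).trans (by exact_mod_cast Nat.lt_succ_iff.mp h)
    have h2 : t / ε ^ 2 - (⌊t / ε ^ 2⌋₊ : ℝ) = 0 := by
      linarith [Nat.floor_le hu]
    rw [h2]; ring
  · rw [h]; ring

lemma mul_rpow_le_rpow_of_mul_sq_le {a ε d : ℝ} (ha₀ : 0 ≤ a) (ha₁ : a ≤ 1) (hε : 0 ≤ ε)
    (h : a * ε ^ 2 ≤ d) : a * ε ^ ((3 : ℝ) / 4) ≤ d ^ ((3 : ℝ) / 8) := by
  calc a * ε ^ ((3 : ℝ) / 4) ≤ a ^ ((3 : ℝ) / 8) * ε ^ ((3 : ℝ) / 4) := by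
        gcongr
        exact Real.self_le_rpow_of_le_one ha₀ ha₁ (by norm_num)
    _ = (a * ε ^ 2) ^ ((3 : ℝ) / 8) := by
        rw [Real.mul_rpow ha₀ (by positivity), ← Real.rpow_natCast ε 2, ← Real.rpow_mul hε]
        norm_num
    _ ≤ d ^ ((3 : ℝ) / 8) := by gcongr

lemma rpow_half_le_mul_rpow {d T : ℝ} (hd : 0 ≤ d) (hdT : d ≤ T) :
    d ^ ((1 : ℝ) / 2) ≤ T ^ ((1 : ℝ) / 8) * d ^ ((3 : ℝ) / 8) := by
  calc d ^ ((1 : ℝ) / 2) = d ^ ((1 : ℝ) / 8) * d ^ ((3 : ℝ) / 8) := by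
        rw [← Real.rpow_add_of_nonneg hd (by norm_num) (by norm_num)]; norm_num
    _ ≤ T ^ ((1 : ℝ) / 8) * d ^ ((3 : ℝ) / 8) := by gcongr

lemma lpNorm_eq_integral_abs_rpow {Ω : Type*} [MeasurableSpace Ω] {μ : Measure Ω} {m : ℝ}
    (hm : 0 < m) {f : Ω → ℝ} (hf : AEStronglyMeasurable f μ) :
    lpNorm f (ENNReal.ofReal m) μ = (∫ ω, |f ω| ^ m ∂μ) ^ (1 / m) := by
  rw [lpNorm_eq_integral_norm_rpow_toReal (by simpa using hm) ENNReal.ofReal_ne_top hf,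
    ENNReal.toReal_ofReal hm.le, one_div]
  simp only [Real.norm_eq_abs]

lemma lpNorm_linInterp_sub_le {Ω : Type*} [MeasurableSpace Ω] {μ : Measure Ω} {p : ENNReal}
    (hp : 1 ≤ p) {T c ε : ℝ} (hc : 0 < c) (hε₀ : 0 < ε) (hε₁ : ε ≤ 1)
    {Y : ℕ → Ω → ℝ} (hY : ∀ i, MemLp (Y i) p μ)
    (hYc : ∀ i j : ℕ, (i : ℝ) * ε ^ 2 ≤ T + ε ^ 2 → (j : ℝ) * ε ^ 2 ≤ T + ε ^ 2 →
      lpNorm (Y i - Y j) p μ ≤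
        c * (|(i : ℝ) * ε ^ 2 - (j : ℝ) * ε ^ 2| ^ ((1 : ℝ) / 2) + ε ^ ((3 : ℝ) / 4)))
    {s t : ℝ} (hs : 0 ≤ s) (hst : s ≤ t) (ht : t ≤ T) :
    lpNorm (linInterp ε Y t - linInterp ε Y s) p μ ≤
      c * (5 + T ^ ((1 : ℝ) / 8)) * (t - s) ^ ((3 : ℝ) / 8) := by
  have hh : 0 < ε ^ 2 := by positivity
  have hd : 0 ≤ t - s := sub_nonneg.2 hst
  have hT : 0 ≤ T := by linarith
  set R := (t - s) ^ ((3 : ℝ) / 8) with hR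
  have hR₀ : 0 ≤ R := by positivity
  have hT8 : 0 ≤ T ^ ((1 : ℝ) / 8) := by positivity
  rw [linInterp_eq_add_smul ε Y (hs.trans hst), linInterp_eq_add_smul ε Y hs]
  obtain ⟨u, hu⟩ : ∃ u, u = t / ε ^ 2 := ⟨_, rfl⟩
  obtain ⟨v, hv⟩ : ∃ v, v = s / ε ^ 2 := ⟨_, rfl⟩
  have hut : u * ε ^ 2 = t := by rw [hu]; field_simp
  have hvs : v * ε ^ 2 = s := by rw [hv]; field_simp
  have hv₀ : 0 ≤ v := by rw [hv]; positivity
  have hvu : v ≤ u := by rw [hu, hv]; gcongr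
  rw [← hu, ← hv]
  have hl₁ := Nat.floor_le (hv₀.trans hvu)
  have hl₂ := Nat.lt_floor_add_one u
  have hk₁ := Nat.floor_le hv₀
  have hk₂ := Nat.lt_floor_add_one v
  have hkl : ⌊v⌋₊ ≤ ⌊u⌋₊ := Nat.floor_le_floor hvu
  set l := ⌊u⌋₊
  set k := ⌊v⌋₊
  have grid {i : ℕ} (hi : (i : ℝ) ≤ u + 1) : (i : ℝ) * ε ^ 2 ≤ T + ε ^ 2 := by nlinarith
  -- Increments of the interpolation inside one grid cell.
  have cell (i : ℕ) (hi : (i : ℝ) ≤ u) (a : ℝ) (ha₀ : 0 ≤ a) (ha₁ : a ≤ 1)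
      (had : a ≤ u - v) : lpNorm (a • (Y (i + 1) - Y i)) p μ ≤ 2 * c * R := by
    have hεε : ε ≤ ε ^ ((3 : ℝ) / 4) :=
      Real.self_le_rpow_of_le_one hε₀.le hε₁ (by norm_num)
    have h1 : lpNorm (Y (i + 1) - Y i) p μ ≤ c * (ε + ε ^ ((3 : ℝ) / 4)) := by
      have := hYc (i + 1) i (grid (by push_cast; linarith)) (grid (by linarith))
      have e : |((i + 1 : ℕ) : ℝ) * ε ^ 2 - (i : ℝ) * ε ^ 2| ^ ((1 : ℝ) / 2) = ε := by
        have : ((i + 1 : ℕ) : ℝ) * ε ^ 2 - (i : ℝ) * ε ^ 2 = ε ^ 2 := by push_cast; ring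
        rw [this, abs_of_pos hh, ← Real.sqrt_eq_rpow, Real.sqrt_sq hε₀.le]
      rwa [e] at this
    have h2 : a * ε ^ ((3 : ℝ) / 4) ≤ R :=
      mul_rpow_le_rpow_of_mul_sq_le ha₀ ha₁ hε₀.le (by nlinarith)
    rw [lpNorm_const_smul, coe_nnnorm, Real.norm_of_nonneg ha₀]
    calc a * lpNorm (Y (i + 1) - Y i) p μ
        ≤ a * (c * (ε ^ ((3 : ℝ) / 4) + ε ^ ((3 : ℝ) / 4))) := by
          gcongr
          exact h1.trans (by gcongr)
      _ = 2 * c * (a * ε ^ ((3 : ℝ) / 4)) := by ring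
      _ ≤ 2 * c * R := by gcongr
  rcases hkl.eq_or_lt with hkl | hkl
  · have e : Y l + (u - l) • (Y (l + 1) - Y l) - (Y k + (v - k) • (Y (k + 1) - Y k)) =
        (u - v) • (Y (l + 1) - Y l) := by
      rw [hkl]; module
    rw [e]
    refine (cell l hl₁ (u - v) (by linarith) (by rw [hkl] at hk₁; linarith) le_rfl).trans ?_
    nlinarith [mul_nonneg hc.le hR₀, mul_nonneg (mul_nonneg hc.le hR₀) hT8]
  · have hkl' : (k : ℝ) + 1 ≤ l := by exact_mod_cast hkl
    have e : Y l + (u - l) • (Y (l + 1) - Y l) - (Y k + (v - k) • (Y (k + 1) - Y k)) =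
        (u - l) • (Y (l + 1) - Y l) + (k + 1 - v) • (Y (k + 1) - Y k) + (Y l - Y (k + 1)) := by
      module
    have mid : lpNorm (Y l - Y (k + 1)) p μ ≤ c * (1 + T ^ ((1 : ℝ) / 8)) * R := by
      rcases (Nat.succ_le_of_lt hkl).eq_or_lt with h | h
      · rw [← h, Nat.succ_eq_add_one, sub_self, lpNorm_zero]
        positivity
      · have h' : (k : ℝ) + 1 + 1 ≤ l := by exact_mod_cast h
        refine (hYc l (k + 1) (grid (by linarith)) (grid (by push_cast; linarith))).trans ?_
        have h1 : |(l : ℝ) * ε ^ 2 - ((k + 1 : ℕ) : ℝ) * ε ^ 2| ≤ t - s := by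
          rw [← sub_mul, abs_of_nonneg (by push_cast; apply mul_nonneg _ hh.le; linarith)]
          push_cast
          nlinarith
        have h2 := mul_rpow_le_rpow_of_mul_sq_le zero_le_one le_rfl hε₀.le
          (show 1 * ε ^ 2 ≤ t - s by nlinarith)
        have h3 := rpow_half_le_mul_rpow hd (show t - s ≤ T by linarith)
        calc _ ≤ c * ((t - s) ^ ((1 : ℝ) / 2) + ε ^ ((3 : ℝ) / 4)) := by gcongr
          _ ≤ c * (T ^ ((1 : ℝ) / 8) * R + R) := by
            gcongr
            simpa using h2
          _ = _ := by ring
    have hA : MemLp ((u - l) • (Y (l + 1) - Y l)) p μ := ((hY _).sub (hY _)).const_smul _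
    have hB : MemLp ((k + 1 - v) • (Y (k + 1) - Y k)) p μ := ((hY _).sub (hY _)).const_smul _
    rw [e]
    have t1 := lpNorm_add_le (g := Y l - Y (k + 1)) (hA.add hB) hp
    have t2 := lpNorm_add_le (g := (k + 1 - v) • (Y (k + 1) - Y k)) hA hp
    have c1 := cell l hl₁ (u - l) (by linarith) (by linarith) (by linarith)
    have c2 := cell k (by linarith) (k + 1 - v) (by linarith) (by linarith) (by linarith)
    linarith

/-- Linearization in time: if the grid values satisfy
`‖Y_t - Y_s‖_{L^m} ≤ c(|t-s|^{1/2} + ε^{3/4})` on `ε²ℕ ∩ [0, T+ε²]`, then the piecewise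
linear interpolation satisfies `‖Ȳ_t - Ȳ_s‖_{L^m} ≤ c' |t-s|^{3/8}` on `[0, T]`, with a
constant `c'` depending only on `c` and `T` (in particular not on `ε`). -/
theorem stmt19 (T c : ℝ) (hT : 0 < T) (hc : 0 < c) :
    ∃ c' : ℝ, 0 < c' ∧
      ∀ m : ℝ, 1 ≤ m → ∀ ε : ℝ, ε ∈ Set.Ioc (0 : ℝ) 1 →
      ∀ (Ω : Type) (_ : MeasurableSpace Ω) (μ : Measure Ω), IsProbabilityMeasure μ →
      ∀ Y : ℕ → Ω → ℝ, (∀ i, Measurable (Y i)) →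
      (∀ i, Integrable (fun ω => |Y i ω| ^ m) μ) →
      (∀ i j : ℕ, (i : ℝ) * ε ^ 2 ≤ T + ε ^ 2 → (j : ℝ) * ε ^ 2 ≤ T + ε ^ 2 →
        (∫ ω, |Y i ω - Y j ω| ^ m ∂μ) ^ (1 / m) ≤
          c * (|(i : ℝ) * ε ^ 2 - (j : ℝ) * ε ^ 2| ^ ((1 : ℝ) / 2) + ε ^ ((3 : ℝ) / 4))) →
      ∀ s t : ℝ, s ∈ Set.Icc 0 T → t ∈ Set.Icc 0 T →
        (∫ ω, |linInterp ε Y t ω - linInterp ε Y s ω| ^ m ∂μ) ^ (1 / m) ≤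
          c' * |t - s| ^ ((3 : ℝ) / 8) := by
  refine ⟨c * (5 + T ^ ((1 : ℝ) / 8)), by positivity, ?_⟩
  intro m hm ε hε Ω _ μ _ Y hYm hYi hYc
  have hm₀ : 0 < m := by linarith
  have hp : 1 ≤ ENNReal.ofReal m := by simpa using hm
  have hY i : MemLp (Y i) (ENNReal.ofReal m) μ := by
    rw [← integrable_norm_rpow_iff (hYm i).aestronglyMeasurable (by simpa using hm₀)
      ENNReal.ofReal_ne_top, ENNReal.toReal_ofReal hm₀.le]
    exact hYi i
  have hL t : Measurable (linInterp ε Y t) :=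
    ((hYm _).const_mul _).add ((hYm _).const_mul _)
  have key (s t : ℝ) (hs : 0 ≤ s) (hst : s ≤ t) (ht : t ≤ T) :=
    lpNorm_linInterp_sub_le hp hc hε.1 hε.2 hY
      (fun i j hi hj => by
        rw [lpNorm_eq_integral_abs_rpow hm₀ ((hYm i).sub (hYm j)).aestronglyMeasurable]
        exact hYc i j hi hj) hs hst ht
  intro s t hs ht
  have e := lpNorm_eq_integral_abs_rpow (μ := μ) hm₀ ((hL t).sub (hL s)).aestronglyMeasurable
  simp only [Pi.sub_apply] at e
  rw [← e]
  rcases le_total s t with h | h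
  · rw [abs_of_nonneg (sub_nonneg.2 h)]
    exact key s t hs.1 h ht.2
  · rw [abs_sub_comm, abs_of_nonneg (sub_nonneg.2 h), lpNorm_sub_comm]
    exact key t s ht.1 h hs.2
end
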